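/- Statement 2.2(e): Let D ≥ 4 be even, j ∈ {1, …, D+1}, B' ∈ φ(V_{D−2}) and B ∈ φ(V_D) such that ⟨B⟩ = τ_j(⟨B'⟩) + F₂·e_j. Then ε(B) = τ_j(ε'(B')) or ε(B) = τ_j(ε'(B')) + e_j, where ε' denotes the ε-map for V_{D−2}. -/

import Mathlib

open scoped BigOperators

/-- `W D` : functions `Z/(D+1) → F₂`. -/
abbrev Wsp (D : ℕ) : Type := ZMod (D + 1) → ZMod 2

/-- The all-ones function. -/
def allOnes (D : ℕ) : Wsp D := fun _ => 1

/-- `V D = W/span{u}`. -/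
abbrev Vsp (D : ℕ) : Type := Wsp D ⧸ Submodule.span (ZMod 2) {allOnes D}

/-- `e i` : image of the standard basis function at `i`. -/
def eV (D : ℕ) (i : ZMod (D + 1)) : Vsp D :=
  Submodule.Quotient.mk (Pi.single i 1)

/-- `e_I = ∑_{s ∈ I} e_s`. -/
def eSet (D : ℕ) (I : Finset (ZMod (D + 1))) : Vsp D := ∑ s ∈ I, eV D s

/-- A cyclic interval (arc): nonempty proper subset of the form `{i, i+1, …, j}`. -/
def IsInterval (D : ℕ) (I : Finset (ZMod (D + 1))) : Prop :=
  ∃ (i : ZMod (D + 1)) (l : ℕ), 1 ≤ l ∧ l ≤ D ∧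
    I = (Finset.range l).image (fun t : ℕ => i + (t : ZMod (D + 1)))

/-- Member of `ℐ¹` : interval of odd cardinality. -/
def OddInterval (D : ℕ) (I : Finset (ZMod (D + 1))) : Prop :=
  IsInterval D I ∧ Odd I.card

/-- `I ≺ I'` : `I ⊊ I'` and `I' − I` is a disjoint union of two intervals. -/
def Prec (D : ℕ) (I I' : Finset (ZMod (D + 1))) : Prop :=
  I ⊂ I' ∧ ∃ I₁ I₂, IsInterval D I₁ ∧ IsInterval D I₂ ∧ Disjoint I₁ I₂ ∧ I' \ I = I₁ ∪ I₂

/-- `I ♠ I'` : `I ∩ I' = ∅` and `I ∪ I'` is not an interval. -/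
def Spade (D : ℕ) (I I' : Finset (ZMod (D + 1))) : Prop :=
  I ∩ I' = ∅ ∧ ¬ IsInterval D (I ∪ I')

/-- `I^ev`. -/
noncomputable def evSet (D : ℕ) (I : Finset (ZMod (D + 1))) : Finset (ZMod (D + 1)) :=
  @Finset.filter _
    (fun i => ∃ I' I'', OddInterval D I' ∧ OddInterval D I'' ∧ Spade D I' I'' ∧
      I.erase i = I' ∪ I'')
    (Classical.decPred _) I

/-- `B ∈ φ(V_D)` : a finite set of elements of `ℐ¹` satisfying (P0) and (P1). -/
def phi (D : ℕ) (B : Finset (Finset (ZMod (D + 1)))) : Prop :=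
  (∀ I ∈ B, OddInterval D I) ∧
  (∀ I ∈ B, ∀ I' ∈ B, I = I' ∨ Spade D I I' ∨ Prec D I I' ∨ Prec D I' I) ∧
  (∀ I ∈ B, ∃ 𝒥 : Finset (Finset (ZMod (D + 1))), 𝒥 ⊆ B ∧
    (∀ J ∈ 𝒥, Prec D J I) ∧
    (∀ J ∈ 𝒥, ∀ J' ∈ 𝒥, J ≠ J' → Disjoint J J') ∧
    evSet D I ⊆ 𝒥.biUnion id)

/-- `⟨B⟩` : the F₂-span of `{e_I : I ∈ B}`. -/
def spanB (D : ℕ) (B : Finset (Finset (ZMod (D + 1)))) : Submodule (ZMod 2) (Vsp D) :=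
  Submodule.span (ZMod 2) (eSet D '' ↑B)

/-- `g_i(B) = |{I ∈ B : i ∈ I}|`. -/
def gB (D : ℕ) (B : Finset (Finset (ZMod (D + 1)))) (i : ZMod (D + 1)) : ℕ :=
  (B.filter (fun I => i ∈ I)).card

/-- `ε(B) = ∑_i (g_i(B)(g_i(B)+1)/2 mod 2) e_i`. -/
def epsB (D : ℕ) (B : Finset (Finset (ZMod (D + 1)))) : Vsp D :=
  ∑ i : ZMod (D + 1), ((gB D B i * (gB D B i + 1) / 2 : ℕ) : ZMod 2) • eV D i

/-- The partial order `B' ≤ B` on `φ(V_D)`. -/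
def leφ (D : ℕ) (B' B : Finset (Finset (ZMod (D + 1)))) : Prop :=
  ∃ (k : ℕ) (c : ℕ → Finset (Finset (ZMod (D + 1)))),
    c 0 = B' ∧ c k = B ∧ (∀ s ≤ k, phi D (c s)) ∧
    ∀ s < k, epsB D (c s) ∈ spanB D (c (s + 1))

/-- `B' < B`. -/
def ltφ (D : ℕ) (B' B : Finset (Finset (ZMod (D + 1)))) : Prop :=
  leφ D B' B ∧ B' ≠ B

/-- `1_E ∈ ℂ[V_D]`, the indicator function of `E ⊆ V_D`. -/
noncomputable def ind (D : ℕ) (E : Set (Vsp D)) : Vsp D → ℂ := E.indicator 1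

/-- `δ_x ∈ ℂ[V_D]`. -/
noncomputable def delta (D : ℕ) (x : Vsp D) : Vsp D → ℂ := ind D {x}

/-- The symplectic form on `W`. -/
def formW (D : ℕ) (x y : Wsp D) : ZMod 2 :=
  ∑ i : ZMod (D + 1), (x i * y (i + 1) + x (i + 1) * y i)

/-- The induced symplectic form on `V_D` (well defined since the form kills `u`). -/
noncomputable def formV (D : ℕ) (x y : Vsp D) : ZMod 2 :=
  formW D (Quotient.out x) (Quotient.out y)

/-- The Fourier transform `ℂ[V_D] → ℂ[V_D]`. -/
noncomputable def fourierV (D : ℕ) (f : Vsp D → ℂ) : Vsp D → ℂ :=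
  fun y => (2 : ℂ) ^ (-((D / 2 : ℕ) : ℤ)) *
    ∑ᶠ x : Vsp D, (if formV D x y = 0 then (1 : ℂ) else -1) * f x

/-- The target in `V_D` of the basis vector `e'_ℓ` of `V_{D-2}` under `τ_j`. -/
noncomputable def tauTgt (D j : ℕ) (ℓ : ZMod (D - 2 + 1)) : Vsp D :=
  let L : ℕ := if ℓ.val = 0 then D - 1 else ℓ.val
  if ℓ = ((j - 1 : ℕ) : ZMod (D - 2 + 1)) then
    eV D ((j : ZMod (D + 1)) - 1) + eV D (j : ZMod (D + 1)) + eV D ((j : ZMod (D + 1)) + 1)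
  else if L < j - 1 then eV D (L : ZMod (D + 1))
  else eV D ((L + 2 : ℕ) : ZMod (D + 1))

/-- The linear embedding `τ_j : V_{D-2} → V_D` (well defined independently of the chosen
representative since the targets sum to `0`). -/
noncomputable def tauMap (D j : ℕ) (x : Vsp (D - 2)) : Vsp D :=
  ∑ i : ZMod (D - 2 + 1), (Quotient.out x) i • tauTgt D j i

section Arcs

variable {D : ℕ}

lemma natCast_inj_of_le {u v : ℕ} (hu : u ≤ D) (hv : v ≤ D)
    (h : (u : ZMod (D + 1)) = v) : u = v := by
  have := congrArg ZMod.val h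
  rwa [ZMod.val_natCast_of_lt (by omega), ZMod.val_natCast_of_lt (by omega)] at this

lemma natCast_eq_neg_one : (D : ZMod (D + 1)) = -1 := by
  have : ((D + 1 : ℕ) : ZMod (D + 1)) = 0 := ZMod.natCast_self _
  push_cast at this
  linear_combination this

/-- The arc of length `l` starting at `a` and running in the direction `s = ±1`. -/
def arc (D : ℕ) (s a : ZMod (D + 1)) (l : ℕ) : Finset (ZMod (D + 1)) :=
  (Finset.range l).image (fun t : ℕ => a + s * (t : ZMod (D + 1)))

lemma dir_mul_self {s : ZMod (D + 1)} (hs : s = 1 ∨ s = -1) : s * s = 1 := by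
  rcases hs with rfl | rfl <;> ring

lemma exists_eq_add_mul {s : ZMod (D + 1)} (hs : s = 1 ∨ s = -1) (a x : ZMod (D + 1)) :
    ∃ u : ℕ, u ≤ D ∧ x = a + s * (u : ZMod (D + 1)) := by
  refine ⟨(s * (x - a)).val, Nat.lt_succ_iff.mp (ZMod.val_lt _), ?_⟩
  rw [ZMod.natCast_zmod_val]
  linear_combination (-(x - a)) * dir_mul_self hs

lemma mem_arc {s : ZMod (D + 1)} (hs : s = 1 ∨ s = -1) {a : ZMod (D + 1)} {l u : ℕ}
    (hl : l ≤ D + 1) (hu : u ≤ D) :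
    a + s * (u : ZMod (D + 1)) ∈ arc D s a l ↔ u < l := by
  simp only [arc, Finset.mem_image, Finset.mem_range]
  constructor
  · rintro ⟨t, ht, h⟩
    have : (t : ZMod (D + 1)) = u := by
      linear_combination s * h + (u - t : ZMod (D + 1)) * dir_mul_self hs
    rwa [← natCast_inj_of_le (by omega) hu this]
  · exact fun h => ⟨u, h, rfl⟩

lemma card_arc {s : ZMod (D + 1)} (hs : s = 1 ∨ s = -1) (a : ZMod (D + 1)) {l : ℕ}
    (hl : l ≤ D + 1) : (arc D s a l).card = l := by
  rw [arc, Finset.card_image_of_injOn, Finset.card_range]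
  intro t ht u hu h
  simp only [Finset.coe_range, Set.mem_Iio] at ht hu
  refine natCast_inj_of_le (D := D) (by omega) (by omega) ?_
  simp only at h
  linear_combination s * h + (u - t : ZMod (D + 1)) * dir_mul_self hs

lemma arc_one_eq_arc_neg_one (a : ZMod (D + 1)) (l : ℕ) :
    arc D 1 a l = arc D (-1) (a + l - 1) l := by
  ext x
  simp only [arc, Finset.mem_image, Finset.mem_range]
  constructor <;>
  · rintro ⟨t, ht, rfl⟩
    refine ⟨l - 1 - t, by omega, ?_⟩
    rw [Nat.sub_sub, Nat.cast_sub (by omega)]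
    push_cast
    ring

lemma isInterval_iff_arc {s : ZMod (D + 1)} (hs : s = 1 ∨ s = -1)
    {I : Finset (ZMod (D + 1))} :
    IsInterval D I ↔ ∃ a l, 1 ≤ l ∧ l ≤ D ∧ I = arc D s a l := by
  rcases hs with rfl | rfl
  · simp only [IsInterval, arc, one_mul]
  · constructor
    · rintro ⟨a, l, h1, h2, rfl⟩
      exact ⟨a + l - 1, l, h1, h2, by rw [← arc_one_eq_arc_neg_one]; simp [arc]⟩
    · rintro ⟨a, l, h1, h2, rfl⟩
      refine ⟨a - (l : ZMod (D + 1)) + 1, l, h1, h2, ?_⟩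
      have := arc_one_eq_arc_neg_one (a - (l : ZMod (D + 1)) + 1) l
      rw [show a - (l : ZMod (D + 1)) + 1 + l - 1 = a by ring] at this
      rw [← this]
      simp [arc]

lemma isInterval_arc {s : ZMod (D + 1)} (hs : s = 1 ∨ s = -1) (a : ZMod (D + 1)) {l : ℕ}
    (h1 : 1 ≤ l) (h2 : l ≤ D) : IsInterval D (arc D s a l) :=
  (isInterval_iff_arc hs).2 ⟨a, l, h1, h2, rfl⟩

lemma left_mem_arc {s a : ZMod (D + 1)} {l : ℕ} (h1 : 1 ≤ l) : a ∈ arc D s a l :=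
  Finset.mem_image.2 ⟨0, Finset.mem_range.2 h1, by simp⟩

lemma sub_dir_notMem_arc {s : ZMod (D + 1)} (hs : s = 1 ∨ s = -1) {a : ZMod (D + 1)} {l : ℕ}
    (h2 : l ≤ D) : a - s ∉ arc D s a l := by
  have h : a - s = a + s * (D : ZMod (D + 1)) := by rw [natCast_eq_neg_one]; ring
  rw [h, mem_arc hs (by omega) le_rfl]
  omega

lemma eq_arc_of_start {s : ZMod (D + 1)} (hs : s = 1 ∨ s = -1)
    {I : Finset (ZMod (D + 1))} (hI : IsInterval D I) {a : ZMod (D + 1)}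
    (ha : a ∈ I) (ha' : a - s ∉ I) : ∃ l, 1 ≤ l ∧ l ≤ D ∧ I = arc D s a l := by
  obtain ⟨b, l, h1, h2, rfl⟩ := (isInterval_iff_arc hs).1 hI
  refine ⟨l, h1, h2, ?_⟩
  obtain ⟨u, hu, rfl⟩ := exists_eq_add_mul hs b a
  rw [mem_arc hs (by omega) hu] at ha
  rcases u with _ | u
  · simp
  · refine absurd ?_ ha'
    rw [show b + s * ((u + 1 : ℕ) : ZMod (D + 1)) - s = b + s * (u : ZMod (D + 1)) by
      push_cast; ring, mem_arc hs (by omega) (by omega)]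
    omega

lemma neg_dir {s : ZMod (D + 1)} (hs : s = 1 ∨ s = -1) : -s = 1 ∨ -s = -1 := by
  rcases hs with rfl | rfl <;> simp

lemma exists_start {s : ZMod (D + 1)} (hs : s = 1 ∨ s = -1)
    {I : Finset (ZMod (D + 1))} (hI : IsInterval D I) : ∃ a, a ∈ I ∧ a - s ∉ I := by
  obtain ⟨a, l, h1, h2, rfl⟩ := (isInterval_iff_arc hs).1 hI
  exact ⟨a, left_mem_arc h1, sub_dir_notMem_arc hs h2⟩

lemma isInterval_eq_of_ends {X Y : Finset (ZMod (D + 1))} (hX : IsInterval D X)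
    (hY : IsInterval D Y) {a b : ZMod (D + 1)} (haX : a ∈ X) (haX' : a - 1 ∉ X)
    (haY : a ∈ Y) (haY' : a - 1 ∉ Y) (hbX : b ∈ X) (hbX' : b + 1 ∉ X)
    (hbY : b ∈ Y) (hbY' : b + 1 ∉ Y) : X = Y := by
  have key : ∀ l : ℕ, 1 ≤ l → l ≤ D → b ∈ arc D 1 a l → b + 1 ∉ arc D 1 a l →
      b = a + ((l - 1 : ℕ) : ZMod (D + 1)) := by
    intro l h1 h2 hb hb'
    obtain ⟨u, hu, rfl⟩ := exists_eq_add_mul (s := 1) (Or.inl rfl) a b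
    rw [mem_arc (Or.inl rfl) (by omega) hu] at hb
    rw [show a + 1 * (u : ZMod (D + 1)) + 1 = a + 1 * ((u + 1 : ℕ) : ZMod (D + 1)) by
      push_cast; ring, mem_arc (Or.inl rfl) (by omega) (by omega)] at hb'
    rw [show u = l - 1 by omega, one_mul]
  obtain ⟨l, hl1, hl2, rfl⟩ := eq_arc_of_start (Or.inl rfl) hX haX haX'
  obtain ⟨m, hm1, hm2, rfl⟩ := eq_arc_of_start (Or.inl rfl) hY haY haY'
  have h := (key l hl1 hl2 hbX hbX').symm.trans (key m hm1 hm2 hbY hbY')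
  have := natCast_inj_of_le (by omega) (by omega) (add_left_cancel h)
  rw [show l = m by omega]

lemma Spade.notMem {I J : Finset (ZMod (D + 1))} (h : Spade D I J) {x : ZMod (D + 1)}
    (hx : x ∈ I) : x ∉ J := fun hx' => by
  have := Finset.mem_inter.2 ⟨hx, hx'⟩
  simp [h.1] at this

lemma Spade.sub_dir_notMem (hD : Even D) {s : ZMod (D + 1)} (hs : s = 1 ∨ s = -1)
    {I J : Finset (ZMod (D + 1))} (hI : OddInterval D I) (hJ : OddInterval D J)
    (h : Spade D I J) {a : ZMod (D + 1)} (ha : a ∈ I) (ha' : a - s ∉ I) : a - s ∉ J := by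
  intro hJa
  obtain ⟨l, hl1, hl2, rfl⟩ := eq_arc_of_start hs hI.1 ha ha'
  obtain ⟨b, m, hm1, hm2, rfl⟩ := (isInterval_iff_arc hs).1 hJ.1
  have hlo := hI.2
  have hmo := hJ.2
  rw [card_arc hs _ (by omega)] at hlo hmo
  have hcard : l + m ≤ D + 1 := by
    rw [← card_arc hs a (l := l) (by omega), ← card_arc hs b (l := m) (by omega),
      ← Finset.card_union_of_disjoint (Finset.disjoint_iff_inter_eq_empty.2 h.1)]
    simpa using Finset.card_le_univ (arc D s a l ∪ arc D s b m)
  obtain ⟨u, hu, hab⟩ := exists_eq_add_mul hs b (a - s)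
  rw [hab, mem_arc hs (by omega) hu] at hJa
  have hum : u + 1 = m := by
    by_contra hne
    refine h.notMem ha ?_
    rw [show a = b + s * ((u + 1 : ℕ) : ZMod (D + 1)) by
      push_cast; linear_combination hab, mem_arc hs (by omega) (by omega)]
    omega
  have hab' : a = b + s * (m : ZMod (D + 1)) := by
    rw [← hum]; push_cast; linear_combination hab
  have hle : m + l ≤ D := by
    rcases hD with ⟨d, rfl⟩
    rcases hlo with ⟨p, rfl⟩
    rcases hmo with ⟨q, rfl⟩
    omega
  refine h.2 ?_
  have : arc D s a l ∪ arc D s b m = arc D s b (m + l) := by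
    ext x
    simp only [arc, Finset.mem_union, Finset.mem_image, Finset.mem_range]
    constructor
    · rintro (⟨t, ht, rfl⟩ | ⟨t, ht, rfl⟩)
      · exact ⟨m + t, by omega, by rw [hab']; push_cast; ring⟩
      · exact ⟨t, by omega, rfl⟩
    · rintro ⟨t, ht, rfl⟩
      by_cases htm : t < m
      · exact Or.inr ⟨t, htm, rfl⟩
      · refine Or.inl ⟨t - m, by omega, ?_⟩
        rw [hab', Nat.cast_sub (by omega)]
        ring
  rw [this]
  exact isInterval_arc hs b (by omega) hle

lemma mem_evSet_arc {s : ZMod (D + 1)} (hs : s = 1 ∨ s = -1) (a : ZMod (D + 1)) {l m : ℕ}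
    (hl : l ≤ D) (hlo : Odd l) (hmo : Odd m) (hml : m < l) :
    a + s * (m : ZMod (D + 1)) ∈ evSet D (arc D s a l) := by
  have hm2 : m + 2 ≤ l := by
    rcases hlo with ⟨p, rfl⟩
    rcases hmo with ⟨q, rfl⟩
    omega
  have hm1 : 1 ≤ m := hmo.pos
  have hro : Odd (l - m - 1) := by
    rcases hlo with ⟨p, rfl⟩
    rcases hmo with ⟨q, rfl⟩
    exact ⟨p - q - 1, by omega⟩
  have hmem : ∀ u : ℕ, u ≤ D →
      (a + s * (u : ZMod (D + 1)) ∈ arc D s (a + s * ((m + 1 : ℕ) : ZMod (D + 1))) (l - m - 1) ↔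
        m < u ∧ u < l) := by
    intro u hu
    constructor
    · intro h
      obtain ⟨t, ht, h⟩ := Finset.mem_image.1 h
      rw [Finset.mem_range] at ht
      have : ((m + 1 + t : ℕ) : ZMod (D + 1)) = u := by
        push_cast at h ⊢
        linear_combination s * h + (u - (m + 1 + t) : ZMod (D + 1)) * dir_mul_self hs
      have := natCast_inj_of_le (D := D) (by omega) hu this
      omega
    · rintro ⟨h1, h2⟩
      refine Finset.mem_image.2 ⟨u - (m + 1), Finset.mem_range.2 (by omega), ?_⟩
      rw [Nat.cast_sub (by omega)]
      ring
  refine (@Finset.mem_filter _ _ (Classical.decPred _) _ _).2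
    ⟨(mem_arc hs (by omega) (by omega)).2 hml, arc D s a m,
    arc D s (a + s * ((m + 1 : ℕ) : ZMod (D + 1))) (l - m - 1),
    ⟨isInterval_arc hs _ hm1 (by omega), by rwa [card_arc hs _ (by omega)]⟩,
    ⟨isInterval_arc hs _ (by omega) (by omega), by rwa [card_arc hs _ (by omega)]⟩,
    ⟨?_, ?_⟩, ?_⟩
  · ext x
    obtain ⟨u, hu, rfl⟩ := exists_eq_add_mul hs a x
    rw [Finset.mem_inter, mem_arc hs (by omega) hu, hmem u hu]
    simp
    omega
  · intro h
    have h0 : a ∈ arc D s a m ∪ arc D s (a + s * ((m + 1 : ℕ) : ZMod (D + 1))) (l - m - 1) :=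
      Finset.mem_union_left _ (left_mem_arc hm1)
    have h0' : a - s ∉
        arc D s a m ∪ arc D s (a + s * ((m + 1 : ℕ) : ZMod (D + 1))) (l - m - 1) := by
      rw [show a - s = a + s * (D : ZMod (D + 1)) by rw [natCast_eq_neg_one]; ring,
        Finset.mem_union, mem_arc hs (by omega) le_rfl, hmem D le_rfl]
      omega
    obtain ⟨k, hk1, hk2, hk⟩ := eq_arc_of_start hs h h0 h0'
    have e1 : a + s * (m : ZMod (D + 1)) ∉ arc D s a k := by
      rw [← hk, Finset.mem_union, mem_arc hs (by omega) (by omega), hmem m (by omega)]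
      omega
    have e2 : a + s * ((m + 1 : ℕ) : ZMod (D + 1)) ∈ arc D s a k := by
      rw [← hk, Finset.mem_union, hmem _ (by omega)]
      omega
    rw [mem_arc hs (by omega) (by omega)] at e1 e2
    omega
  · ext x
    obtain ⟨u, hu, rfl⟩ := exists_eq_add_mul hs a x
    have hne : a + s * (u : ZMod (D + 1)) = a + s * (m : ZMod (D + 1)) ↔ u = m := by
      constructor
      · intro h
        refine natCast_inj_of_le (D := D) hu (by omega) ?_
        linear_combination s * h + (m - u : ZMod (D + 1)) * dir_mul_self hs
      · rintro rfl; rfl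
    rw [Finset.mem_erase, Finset.mem_union, mem_arc hs (by omega) hu,
      mem_arc hs (by omega) hu, hmem u hu, Ne, hne]
    omega

/-- A member of `B ∈ φ(V_D)` properly contained in another one avoids the ends of the latter. -/
lemma phi.start_notMem (hD : Even D) {B : Finset (Finset (ZMod (D + 1)))} (hB : phi D B)
    {s : ZMod (D + 1)} (hs : s = 1 ∨ s = -1) {I J : Finset (ZMod (D + 1))} (hI : I ∈ B)
    (hJ : J ∈ B) (hJI : J ⊂ I) {a : ZMod (D + 1)} (ha : a ∈ I) (ha' : a - s ∉ I) : a ∉ J := by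
  intro haJ
  obtain ⟨K, hK, hmax⟩ := Finset.exists_max_image (B.filter fun K => K ⊂ I ∧ a ∈ K)
    Finset.card ⟨J, Finset.mem_filter.2 ⟨hJ, hJI, haJ⟩⟩
  obtain ⟨hKB, hKI, haK⟩ := Finset.mem_filter.1 hK
  have haK' : a - s ∉ K := fun h => ha' (hKI.1 h)
  obtain ⟨l, hl1, hl2, hIl⟩ := eq_arc_of_start hs (hB.1 I hI).1 ha ha'
  obtain ⟨m, hm1, hm2, hKm⟩ := eq_arc_of_start hs (hB.1 K hKB).1 haK haK'
  have hlo := (hB.1 I hI).2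
  have hmo := (hB.1 K hKB).2
  have hml := Finset.card_lt_card hKI
  rw [hIl, card_arc hs _ (by omega)] at hlo hml
  rw [hKm, card_arc hs _ (by omega)] at hmo hml
  have hev := mem_evSet_arc hs a hl2 hlo hmo hml
  rw [← hIl] at hev
  obtain ⟨𝒥, h𝒥B, h𝒥I, -, hcov⟩ := hB.2.2 I hI
  obtain ⟨L, hL, hmL⟩ := Finset.mem_biUnion.1 (hcov hev)
  have hLB := h𝒥B hL
  have hnext : a + s * (m : ZMod (D + 1)) ∉ K := by
    rw [hKm, mem_arc hs (by omega) (by omega)]; omega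
  have hlast : a + s * ((m - 1 : ℕ) : ZMod (D + 1)) ∈ K := by
    rw [hKm, mem_arc hs (by omega) (by omega)]; omega
  have hstep : a + s * (m : ZMod (D + 1)) = a + s * ((m - 1 : ℕ) : ZMod (D + 1)) - -s := by
    rw [Nat.cast_sub hm1]; push_cast; ring
  rcases hB.2.1 K hKB L hLB with rfl | h | h | h
  · exact hnext hmL
  · rw [hstep] at hmL hnext
    exact h.sub_dir_notMem hD (neg_dir hs) (hB.1 K hKB) (hB.1 L hLB) hlast hnext hmL
  · have := hmax L (Finset.mem_filter.2 ⟨hLB, (h𝒥I L hL).1, h.1.1 haK⟩)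
    exact absurd (Finset.card_lt_card h.1) (by omega)
  · exact hnext (h.1.1 hmL)

lemma IsInterval.compl {I : Finset (ZMod (D + 1))} (hI : IsInterval D I) :
    IsInterval D Iᶜ := by
  obtain ⟨a, l, h1, h2, rfl⟩ := (isInterval_iff_arc (Or.inl rfl)).1 hI
  have : (arc D 1 a l)ᶜ = arc D 1 (a + l) (D + 1 - l) := by
    refine (Finset.eq_of_subset_of_card_le (fun x hx => ?_) ?_).symm
    · obtain ⟨t, ht, rfl⟩ := Finset.mem_image.1 hx
      rw [Finset.mem_range] at ht
      rw [Finset.mem_compl, show a + (l : ZMod (D + 1)) + 1 * (t : ZMod (D + 1)) =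
        a + 1 * ((l + t : ℕ) : ZMod (D + 1)) by push_cast; ring,
        mem_arc (Or.inl rfl) (by omega) (by omega)]
      omega
    · rw [Finset.card_compl, card_arc (Or.inl rfl) _ (by omega),
        card_arc (Or.inl rfl) _ (by omega), ZMod.card]
  rw [this]
  exact isInterval_arc (Or.inl rfl) _ (by omega) (by omega)

end Arcs

section Spans

variable {D : ℕ}

/-- The class in `V_D` of a function on `Z/(D+1)`. -/
def toV (D : ℕ) : Wsp D →ₗ[ZMod 2] Vsp D :=
  (Submodule.span (ZMod 2) {allOnes D}).mkQ

lemma toV_surjective : Function.Surjective (toV D) := Submodule.mkQ_surjective _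

lemma toV_out (x : Vsp D) : toV D (Quotient.out x) = x := Quotient.out_eq' x

lemma toV_eq_iff {f g : Wsp D} : toV D f = toV D g ↔ ∃ c : ZMod 2, ∀ x, f x = g x + c := by
  rw [toV, Submodule.mkQ_apply, Submodule.mkQ_apply, Submodule.Quotient.eq,
    Submodule.mem_span_singleton]
  refine exists_congr fun c => ⟨fun h x => ?_, fun h => ?_⟩
  · have := congrFun h x
    simp only [allOnes, Pi.smul_apply, Pi.sub_apply, smul_eq_mul, mul_one] at this
    rw [this]; ring
  · ext x
    simp [allOnes, h x]

/-- The indicator function of a set of indices, with values in `F₂`. -/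
def indW (I : Finset (ZMod (D + 1))) : Wsp D := fun x => if x ∈ I then 1 else 0

lemma sum_smul_eV (f : Wsp D) : ∑ i, f i • eV D i = toV D f := by
  conv_rhs => rw [pi_eq_sum_univ' f]
  rw [map_sum]
  refine Finset.sum_congr rfl fun i _ => ?_
  rw [map_smul]
  congr 2

lemma eSet_eq (I : Finset (ZMod (D + 1))) : eSet D I = toV D (indW I) := by
  rw [← sum_smul_eV, eSet]
  simp [indW, ite_smul, Finset.sum_ite_mem]

lemma eV_eq (i : ZMod (D + 1)) : eV D i = toV D (indW {i}) := by
  rw [← eSet_eq, eSet, Finset.sum_singleton]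

lemma zmod_two_cases (c : ZMod 2) : c = 0 ∨ c = 1 := by
  revert c; decide

/-- An interval whose indicator function is a sum of indicators of members of `B` is in `B`. -/
lemma phi.mem_of_indW_eq_sum (hD : Even D) {B : Finset (Finset (ZMod (D + 1)))} (hB : phi D B)
    {X : Finset (ZMod (D + 1))} (hX : IsInterval D X) {c : Finset (ZMod (D + 1)) → ZMod 2}
    (h : ∀ x, indW X x = ∑ J ∈ B, c J * indW J x) : X ∈ B := by
  have hne : (B.filter fun J => c J ≠ 0).Nonempty := by
    by_contra hne
    rw [Finset.not_nonempty_iff_eq_empty, Finset.filter_eq_empty_iff] at hne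
    obtain ⟨x, hx, -⟩ := exists_start (Or.inl rfl) hX
    have := h x
    rw [Finset.sum_eq_zero fun J hJ => by rw [not_not.1 (hne hJ), zero_mul]] at this
    simp [indW, hx] at this
  obtain ⟨I, hI, hmax⟩ := Finset.exists_max_image _ Finset.card hne
  obtain ⟨hIB, hcI⟩ := Finset.mem_filter.1 hI
  have hcI : c I = 1 := (zmod_two_cases _).resolve_left hcI
  have hstart : ∀ s : ZMod (D + 1), s = 1 ∨ s = -1 → ∀ a, a ∈ I → a - s ∉ I →
      a ∈ X ∧ a - s ∉ X := by
    intro s hs a ha ha'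
    have h1 : indW X a = 1 := by
      rw [h a, Finset.sum_eq_single I]
      · simp [hcI, indW, ha]
      · intro J hJ hne
        by_cases hcJ : c J = 0
        · rw [hcJ, zero_mul]
        suffices a ∉ J by simp [indW, this]
        rcases hB.2.1 I hIB J hJ with h | h | h | h
        · exact absurd h.symm hne
        · exact h.notMem ha
        · exact absurd (Finset.card_lt_card h.1)
            (not_lt.2 (hmax J (Finset.mem_filter.2 ⟨hJ, hcJ⟩)))
        · exact hB.start_notMem hD hs hIB hJ h.1 ha ha'
      · exact fun h => absurd hIB h
    have h2 : indW X (a - s) = 0 := by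
      rw [h (a - s)]
      refine Finset.sum_eq_zero fun J hJ => ?_
      by_cases hcJ : c J = 0
      · rw [hcJ, zero_mul]
      suffices a - s ∉ J by simp [indW, this]
      rcases hB.2.1 I hIB J hJ with rfl | h | h | h
      · exact ha'
      · exact h.sub_dir_notMem hD hs (hB.1 I hIB) (hB.1 J hJ) ha ha'
      · exact absurd (Finset.card_lt_card h.1)
          (not_lt.2 (hmax J (Finset.mem_filter.2 ⟨hJ, hcJ⟩)))
      · exact fun hm => ha' (h.1.1 hm)
    constructor
    · by_contra hh; simp [indW, hh] at h1
    · intro hh; simp [indW, hh] at h2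
  have hII := (hB.1 I hIB).1
  obtain ⟨a, ha, ha'⟩ := exists_start (Or.inl rfl) hII
  obtain ⟨b, hb, hb'⟩ := exists_start (Or.inr rfl) hII
  obtain ⟨haX, haX'⟩ := hstart 1 (Or.inl rfl) a ha ha'
  obtain ⟨hbX, hbX'⟩ := hstart (-1) (Or.inr rfl) b hb hb'
  rw [sub_neg_eq_add] at hb' hbX'
  rwa [isInterval_eq_of_ends hX hII haX haX' ha ha' hbX hbX' hb hb']

lemma indW_compl (I : Finset (ZMod (D + 1))) (x : ZMod (D + 1)) :
    indW Iᶜ x = indW I x + 1 := by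
  by_cases hx : x ∈ I
  · simp only [indW, Finset.mem_compl, hx, not_true_eq_false, if_true, if_false]; decide
  · simp [indW, hx]

lemma phi.mem_of_eSet_mem (hD : Even D) {B : Finset (Finset (ZMod (D + 1)))} (hB : phi D B)
    {X : Finset (ZMod (D + 1))} (hX : OddInterval D X) (h : eSet D X ∈ spanB D B) : X ∈ B := by
  obtain ⟨c, hc⟩ := (Submodule.mem_span_image_finset_iff_exists_fun' (ZMod 2)).1 h
  have hsum : toV D (∑ J ∈ B, c J • indW J) = toV D (indW X) := by
    rw [← eSet_eq, ← hc, map_sum]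
    exact Finset.sum_congr rfl fun J _ => by rw [map_smul, eSet_eq]
  obtain ⟨d, hd⟩ := toV_eq_iff.1 hsum.symm
  simp only [Finset.sum_apply, Pi.smul_apply, smul_eq_mul] at hd
  rcases zmod_two_cases d with rfl | rfl
  · exact hB.mem_of_indW_eq_sum hD hX.1 (by simpa using hd)
  · have hmem := hB.mem_of_indW_eq_sum hD hX.1.compl (c := c) fun x => by
      rw [indW_compl, hd x, add_assoc, CharTwo.add_self_eq_zero, add_zero]
    have hodd := (hB.1 _ hmem).2
    rw [Finset.card_compl, ZMod.card] at hodd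
    have hle := Finset.card_le_univ X
    rw [ZMod.card] at hle
    have := hX.2
    rcases hD with ⟨d, rfl⟩
    rcases this with ⟨p, hp⟩
    rcases hodd with ⟨q, hq⟩
    omega

lemma phi.mem_iff_eSet_mem (hD : Even D) {B : Finset (Finset (ZMod (D + 1)))} (hB : phi D B)
    {X : Finset (ZMod (D + 1))} (hX : OddInterval D X) : X ∈ B ↔ eSet D X ∈ spanB D B :=
  ⟨fun h => Submodule.subset_span ⟨X, h, rfl⟩, hB.mem_of_eSet_mem hD hX⟩

/-- The coefficients of `ε(B)`. -/
def epsW (B : Finset (Finset (ZMod (D + 1)))) : Wsp D :=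
  fun i => ((gB D B i * (gB D B i + 1) / 2 : ℕ) : ZMod 2)

lemma epsB_eq (B : Finset (Finset (ZMod (D + 1)))) : epsB D B = toV D (epsW B) :=
  sum_smul_eV _

end Spans

section Collapse

variable {D : ℕ}

/-- The elements of `Z/(D+1)` whose distance from `c` in the positive direction is in `[p, q)`. -/
def lin (c : ZMod (D + 1)) (p q : ℕ) : Finset (ZMod (D + 1)) :=
  Finset.univ.filter fun x => p ≤ (x - c).val ∧ (x - c).val < q

lemma lin_eq_arc (c : ZMod (D + 1)) {p q : ℕ} (hq : q ≤ D + 1) :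
    lin c p q = arc D 1 (c + p) (q - p) := by
  ext x
  simp only [lin, arc, Finset.mem_filter, Finset.mem_univ, true_and, Finset.mem_image,
    Finset.mem_range]
  constructor
  · rintro ⟨h1, h2⟩
    refine ⟨(x - c).val - p, by omega, ?_⟩
    rw [Nat.cast_sub h1, ZMod.natCast_zmod_val]
    ring
  · rintro ⟨t, ht, rfl⟩
    rw [show c + (p : ZMod (D + 1)) + 1 * (t : ZMod (D + 1)) - c = ((p + t : ℕ) : ZMod (D + 1)) by
      push_cast; ring, ZMod.val_natCast_of_lt (by omega)]
    omega

lemma oddInterval_lin (c : ZMod (D + 1)) {p q : ℕ} (hp : 1 ≤ p) (hq : q ≤ D + 1)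
    (hodd : Odd (q - p)) : OddInterval D (lin c p q) := by
  have := hodd.pos
  rw [lin_eq_arc c hq]
  exact ⟨isInterval_arc (Or.inl rfl) _ (by omega) (by omega),
    by rwa [card_arc (Or.inl rfl) _ (by omega)]⟩

lemma IsInterval.exists_lin {I : Finset (ZMod (D + 1))} (hI : IsInterval D I)
    {c : ZMod (D + 1)} (hc : c ∉ I) :
    ∃ p q, 1 ≤ p ∧ p < q ∧ q ≤ D + 1 ∧ I = lin c p q := by
  obtain ⟨a, l, h1, h2, rfl⟩ := (isInterval_iff_arc (Or.inl rfl)).1 hI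
  obtain ⟨u, hu, rfl⟩ := exists_eq_add_mul (s := 1) (Or.inl rfl) c a
  have hu1 : 1 ≤ u := by
    by_contra h
    obtain rfl : u = 0 := by omega
    exact hc (by simpa using left_mem_arc (s := 1) (a := c) h1)
  have hul : u + l ≤ D + 1 := by
    by_contra h
    refine hc (Finset.mem_image.2 ⟨D + 1 - u, Finset.mem_range.2 (by omega), ?_⟩)
    rw [Nat.cast_sub (by omega), ZMod.natCast_self]
    ring
  refine ⟨u, u + l, hu1, by omega, hul, ?_⟩
  rw [lin_eq_arc c hul, one_mul, Nat.add_sub_cancel_left]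

/-- The map `Z/(D+1) → Z/(D-1)` collapsing `{j-1, j, j+1}` to `j-1`. -/
def collapse (D j : ℕ) (x : ZMod (D + 1)) : ZMod (D - 2 + 1) :=
  ((j - 1 : ℕ) : ZMod (D - 2 + 1)) +
    ((if (x - (j + 1)).val ≤ D - 2 then (x - (j + 1)).val else 0 : ℕ) : ZMod (D - 2 + 1))

lemma val_collapse_sub (j : ℕ) (x : ZMod (D + 1)) :
    (collapse D j x - ((j - 1 : ℕ) : ZMod (D - 2 + 1))).val =
      if (x - (j + 1)).val ≤ D - 2 then (x - (j + 1)).val else 0 := by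
  rw [collapse, add_sub_cancel_left, ZMod.val_natCast_of_lt]
  split_ifs <;> omega

lemma val_add_natCast_sub (c : ZMod (D + 1)) {u : ℕ} (hu : u ≤ D) :
    (c + (u : ZMod (D + 1)) - c).val = u := by
  rw [add_sub_cancel_left, ZMod.val_natCast_of_lt (by omega)]

lemma val_eq_iff {c x : ZMod (D + 1)} {u : ℕ} (hu : u ≤ D) :
    (x - c).val = u ↔ x = c + (u : ZMod (D + 1)) := by
  constructor
  · rintro rfl
    rw [ZMod.natCast_zmod_val]; ring
  · rintro rfl
    exact val_add_natCast_sub c hu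

lemma val_eq_last_iff {j : ℕ} {x : ZMod (D + 1)} :
    (x - (j + 1)).val = D ↔ x = (j : ZMod (D + 1)) := by
  rw [val_eq_iff le_rfl, natCast_eq_neg_one, add_neg_cancel_right]

lemma natCast_pred_eq (hD : 4 ≤ D) : ((D - 1 : ℕ) : ZMod (D + 1)) = -2 := by
  rw [Nat.cast_sub (by omega), natCast_eq_neg_one]; push_cast; ring

lemma collapse_eq_base_iff (hD : 4 ≤ D) {j : ℕ} {x : ZMod (D + 1)} :
    collapse D j x = ((j - 1 : ℕ) : ZMod (D - 2 + 1)) ↔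
      x = (j : ZMod (D + 1)) - 1 ∨ x = j ∨ x = (j : ZMod (D + 1)) + 1 := by
  have h : x = (j : ZMod (D + 1)) - 1 ↔ (x - (j + 1)).val = D - 1 := by
    rw [val_eq_iff (by omega), natCast_pred_eq hD]
    ring_nf
  have h0 : x = (j : ZMod (D + 1)) + 1 ↔ (x - (j + 1)).val = 0 := by
    rw [val_eq_iff (by omega)]
    simp
  rw [← sub_eq_zero, ← ZMod.val_eq_zero, val_collapse_sub, h, h0, ← val_eq_last_iff]
  have := ZMod.val_lt (x - ((j : ZMod (D + 1)) + 1))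
  split_ifs <;> omega

lemma exists_collapse_eq (hD : 4 ≤ D) (j : ℕ) (y : ZMod (D - 2 + 1)) :
    ∃ x, x ≠ (j : ZMod (D + 1)) ∧ collapse D j x = y := by
  have hlt := ZMod.val_lt (y - ((j - 1 : ℕ) : ZMod (D - 2 + 1)))
  have hv := val_add_natCast_sub ((j : ZMod (D + 1)) + 1)
    (u := (y - ((j - 1 : ℕ) : ZMod (D - 2 + 1))).val) (by omega)
  refine ⟨(j : ZMod (D + 1)) + 1 + ((y - ((j - 1 : ℕ) : ZMod (D - 2 + 1))).val : ZMod (D + 1)),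
    ?_, ?_⟩
  · rw [Ne, ← val_eq_last_iff, hv]
    omega
  · rw [collapse, hv, if_pos (by omega), ZMod.natCast_zmod_val]
    ring

/-- The preimage of a set of indices under `collapse`. -/
def pre (D j : ℕ) (I : Finset (ZMod (D - 2 + 1))) : Finset (ZMod (D + 1)) :=
  Finset.univ.filter fun x => collapse D j x ∈ I

@[simp] lemma mem_pre {j : ℕ} {I : Finset (ZMod (D - 2 + 1))} {x : ZMod (D + 1)} :
    x ∈ pre D j I ↔ collapse D j x ∈ I := by simp [pre]

lemma pre_compl (j : ℕ) (I : Finset (ZMod (D - 2 + 1))) : pre D j Iᶜ = (pre D j I)ᶜ := by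
  ext x; simp

lemma pre_lin (j : ℕ) {p q : ℕ} (hD : 4 ≤ D) (hp : 1 ≤ p) (hq : q ≤ D - 1) :
    pre D j (lin ((j - 1 : ℕ) : ZMod (D - 2 + 1)) p q) = lin ((j : ZMod (D + 1)) + 1) p q := by
  ext x
  simp only [mem_pre, lin, Finset.mem_filter, Finset.mem_univ, true_and, val_collapse_sub]
  split_ifs <;> omega

lemma card_lin (c : ZMod (D + 1)) {p q : ℕ} (hq : q ≤ D + 1) : (lin c p q).card = q - p := by
  rw [lin_eq_arc c hq, card_arc (Or.inl rfl) _ (by omega)]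

lemma isInterval_lin (c : ZMod (D + 1)) {p q : ℕ} (hp : 1 ≤ p) (hpq : p < q) (hq : q ≤ D + 1) :
    IsInterval D (lin c p q) := by
  rw [lin_eq_arc c hq]
  exact isInterval_arc (Or.inl rfl) _ (by omega) (by omega)

lemma oddInterval_compl_iff (hD : Even D) {I : Finset (ZMod (D + 1))} :
    OddInterval D Iᶜ ↔ IsInterval D I ∧ Even I.card := by
  have hc : IsInterval D Iᶜ ↔ IsInterval D I :=
    ⟨fun h => compl_compl I ▸ h.compl, fun h => h.compl⟩
  have hle := Finset.card_le_univ I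
  rw [ZMod.card] at hle
  rw [OddInterval, hc, Finset.card_compl, ZMod.card, Nat.odd_sub hle]
  have : Odd (D + 1) := hD.add_one
  simp [this]

lemma oddInterval_pre (hD : 4 ≤ D) (hDev : Even D) (j : ℕ) {I : Finset (ZMod (D - 2 + 1))}
    (hI : OddInterval (D - 2) I) : OddInterval D (pre D j I) := by
  have hDev' : Even (D - 2) := by
    rcases hDev with ⟨d, rfl⟩
    exact ⟨d - 1, by omega⟩
  by_cases hj : ((j - 1 : ℕ) : ZMod (D - 2 + 1)) ∈ I
  · rw [← compl_compl I] at hI ⊢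
    obtain ⟨h1, h2⟩ := (oddInterval_compl_iff hDev').1 hI
    obtain ⟨p, q, hp, hpq, hq, h⟩ := h1.exists_lin
      (c := ((j - 1 : ℕ) : ZMod (D - 2 + 1))) (by simpa using hj)
    rw [pre_compl, oddInterval_compl_iff hDev]
    rw [h, card_lin _ hq] at h2
    rw [h, pre_lin j hD hp (by omega), card_lin _ (by omega)]
    exact ⟨isInterval_lin _ hp hpq (by omega), h2⟩
  · obtain ⟨p, q, hp, hpq, hq, rfl⟩ := hI.1.exists_lin hj
    have h2 := hI.2
    rw [card_lin _ hq] at h2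
    rw [pre_lin j hD hp (by omega)]
    exact oddInterval_lin _ hp (by omega) h2

lemma exists_lin_pre (hD : 4 ≤ D) {j : ℕ} {I : Finset (ZMod (D + 1))} (hI : IsInterval D I)
    (h0 : (j : ZMod (D + 1)) - 1 ∉ I) (h1 : (j : ZMod (D + 1)) ∉ I)
    (h2 : (j : ZMod (D + 1)) + 1 ∉ I) :
    ∃ I', IsInterval (D - 2) I' ∧ I'.card = I.card ∧ pre D j I' = I := by
  obtain ⟨p, q, hp, hpq, hq, rfl⟩ := hI.exists_lin h2
  have hlast : ((j : ZMod (D + 1)) - ((j : ZMod (D + 1)) + 1)).val = D :=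
    val_eq_last_iff.2 rfl
  have hpred : ((j : ZMod (D + 1)) - 1 - ((j : ZMod (D + 1)) + 1)).val = D - 1 := by
    rw [val_eq_iff (by omega), natCast_pred_eq hD]
    ring
  simp only [lin, Finset.mem_filter, Finset.mem_univ, true_and, hlast, hpred] at h0 h1
  have hq' : q ≤ D - 1 := by omega
  refine ⟨lin ((j - 1 : ℕ) : ZMod (D - 2 + 1)) p q, isInterval_lin _ hp hpq (by omega), ?_,
    pre_lin j hD hp hq'⟩
  rw [card_lin _ (by omega), card_lin _ (by omega)]

lemma exists_oddInterval_pre (hD : 4 ≤ D) (hDev : Even D) {j : ℕ} {I : Finset (ZMod (D + 1))}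
    (hI : OddInterval D I) (h0 : (j : ZMod (D + 1)) - 1 ∈ I ↔ (j : ZMod (D + 1)) ∈ I)
    (h2 : (j : ZMod (D + 1)) + 1 ∈ I ↔ (j : ZMod (D + 1)) ∈ I) :
    ∃ I', OddInterval (D - 2) I' ∧ pre D j I' = I := by
  have hDev' : Even (D - 2) := by
    rcases hDev with ⟨d, rfl⟩
    exact ⟨d - 1, by omega⟩
  by_cases hj : (j : ZMod (D + 1)) ∈ I
  · rw [← compl_compl I, oddInterval_compl_iff hDev] at hI
    obtain ⟨I', h, hc, hpre⟩ := exists_lin_pre hD (j := j) hI.1 (by simpa using h0.2 hj)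
      (by simpa using hj) (by simpa using h2.2 hj)
    exact ⟨I'ᶜ, (oddInterval_compl_iff hDev').2 ⟨h, hc ▸ hI.2⟩, by
      rw [pre_compl, hpre, compl_compl]⟩
  · obtain ⟨I', h, hc, hpre⟩ := exists_lin_pre hD (j := j) hI.1 (fun h => hj (h0.1 h)) hj
      (fun h => hj (h2.1 h))
    exact ⟨I', ⟨h, hc ▸ hI.2⟩, hpre⟩

lemma tauTgt_eq (hD : 4 ≤ D) {j : ℕ} (hj1 : 1 ≤ j) (hj2 : j ≤ D + 1) (y : ZMod (D - 2 + 1)) :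
    tauTgt D j y = toV D (indW (pre D j {y})) := by
  rw [← eSet_eq]
  unfold tauTgt
  by_cases hy : y = ((j - 1 : ℕ) : ZMod (D - 2 + 1))
  · have hpre : pre D j {y} =
        {(j : ZMod (D + 1)) - 1, (j : ZMod (D + 1)), (j : ZMod (D + 1)) + 1} := by
      ext x
      rw [mem_pre, Finset.mem_singleton, hy, collapse_eq_base_iff hD]
      simp
    have h1 : (1 : ZMod (D + 1)) ≠ 0 := fun h => by
      have := natCast_inj_of_le (D := D) (u := 1) (v := 0) (by omega) (by omega) (by simpa using h)
      omega
    have h2 : (2 : ZMod (D + 1)) ≠ 0 := fun h => by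
      have := natCast_inj_of_le (D := D) (u := 2) (v := 0) (by omega) (by omega) (by simpa using h)
      omega
    simp only [if_pos hy]
    rw [hpre, eSet, Finset.sum_insert, Finset.sum_pair, add_assoc]
    · intro h; exact h1 (by linear_combination -h)
    · simp only [Finset.mem_insert, Finset.mem_singleton, not_or]
      exact ⟨fun h => h1 (by linear_combination -h), fun h => h2 (by linear_combination -h)⟩
  · simp only [if_neg hy]
    obtain ⟨L, hL1, hL2, hL, hyL⟩ : ∃ L : ℕ, 1 ≤ L ∧ L ≤ D - 1 ∧
        (if y.val = 0 then D - 1 else y.val) = L ∧ y = (L : ZMod (D - 2 + 1)) := by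
      refine ⟨_, ?_, ?_, rfl, ?_⟩
      · split_ifs <;> omega
      · have := ZMod.val_lt y
        split_ifs <;> omega
      · split_ifs with h
        · rw [(ZMod.val_eq_zero y).1 h, show D - 1 = D - 2 + 1 by omega, ZMod.natCast_self]
        · rw [ZMod.natCast_zmod_val]
    rw [hL]
    have key : ∀ k : ℕ, k ≤ D - 2 → y = ((j - 1 : ℕ) : ZMod (D - 2 + 1)) + (k : ZMod (D - 2 + 1)) →
        pre D j {y} = {(j : ZMod (D + 1)) + 1 + (k : ZMod (D + 1))} := by
      intro k hk hyk
      have hk0 : k ≠ 0 := by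
        rintro rfl
        exact hy (by simpa using hyk)
      ext x
      rw [mem_pre, Finset.mem_singleton, Finset.mem_singleton, hyk, ← val_eq_iff hk,
        ← val_eq_iff (by omega), val_collapse_sub]
      split_ifs <;> omega
    have hne : L ≠ j - 1 := by
      rintro rfl; exact hy hyL
    have hz : ((D - 1 : ℕ) : ZMod (D - 2 + 1)) = 0 := by
      rw [show D - 1 = D - 2 + 1 by omega, ZMod.natCast_self]
    have hz' : ((D + 1 : ℕ) : ZMod (D + 1)) = 0 := ZMod.natCast_self _
    split_ifs with hlt
    · have hle : L + (D - 1) - (j - 1) ≤ D - 2 := by omega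
      have h0 : (j - 1) + (L + (D - 1) - (j - 1)) = L + (D - 1) := by omega
      rw [key _ hle (by rw [hyL, ← Nat.cast_add, h0, Nat.cast_add, hz, add_zero]), eSet,
        Finset.sum_singleton]
      congr 1
      have : j + 1 + (L + (D - 1) - (j - 1)) = L + (D + 1) := by omega
      calc (L : ZMod (D + 1)) = ((L + (D + 1) : ℕ) : ZMod (D + 1)) := by
            rw [Nat.cast_add, hz', add_zero]
        _ = _ := by rw [← this]; push_cast; ring
    · have hle : L - (j - 1) ≤ D - 2 := by
        by_contra h
        have hLj : L = D - 1 ∧ j = 1 := by omega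
        refine hy ?_
        rw [hyL, hLj.1, hLj.2, hz]
        simp
      rw [key _ hle (by rw [hyL, ← Nat.cast_add]; congr 1; omega), eSet, Finset.sum_singleton]
      congr 1
      have : j + 1 + (L - (j - 1)) = L + 2 := by omega
      rw [← this, Nat.cast_add, Nat.cast_add, Nat.cast_one]

lemma tauMap_toV (hD : 4 ≤ D) {j : ℕ} (hj1 : 1 ≤ j) (hj2 : j ≤ D + 1) (f : Wsp (D - 2)) :
    tauMap D j (toV (D - 2) f) = toV D (f ∘ collapse D j) := by
  have h : ∀ g : Wsp (D - 2), ∑ y, g y • tauTgt D j y = toV D (g ∘ collapse D j) := by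
    intro g
    simp only [tauTgt_eq hD hj1 hj2, ← map_smul]
    rw [← map_sum]
    congr 1
    ext x
    simp [indW, Finset.sum_apply]
  rw [tauMap, h, toV_eq_iff]
  obtain ⟨c, hc⟩ := toV_eq_iff.1 (toV_out (toV (D - 2) f))
  exact ⟨c, fun x => hc _⟩

lemma eSet_pre (hD : 4 ≤ D) {j : ℕ} (hj1 : 1 ≤ j) (hj2 : j ≤ D + 1)
    (I : Finset (ZMod (D - 2 + 1))) : tauMap D j (eSet (D - 2) I) = eSet D (pre D j I) := by
  rw [eSet_eq, eSet_eq, tauMap_toV hD hj1 hj2]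
  congr 1
  ext x
  simp [indW]

lemma pre_injective (hD : 4 ≤ D) (j : ℕ) : Function.Injective (pre D j) := by
  intro I J h
  ext y
  obtain ⟨x, -, rfl⟩ := exists_collapse_eq hD j y
  rw [← mem_pre, h, mem_pre]

lemma eq_of_tauMap_add_eq (hD : 4 ≤ D) {j : ℕ} (hj1 : 1 ≤ j) (hj2 : j ≤ D + 1)
    {x y : Vsp (D - 2)} {c : ZMod 2}
    (h : tauMap D j x = tauMap D j y + c • eV D (j : ZMod (D + 1))) : x = y := by
  obtain ⟨f, rfl⟩ := toV_surjective x
  obtain ⟨g, rfl⟩ := toV_surjective y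
  rw [tauMap_toV hD hj1 hj2, tauMap_toV hD hj1 hj2, eV_eq, ← map_smul, ← map_add] at h
  obtain ⟨d, hd⟩ := toV_eq_iff.1 h
  refine toV_eq_iff.2 ⟨d, fun z => ?_⟩
  obtain ⟨x, hx, rfl⟩ := exists_collapse_eq hD j z
  simpa [indW, hx] using hd x

end Collapse

section Main

variable {D : ℕ}

lemma oddInterval_singleton (hD : 4 ≤ D) (i : ZMod (D + 1)) : OddInterval D {i} :=
  ⟨⟨i, 1, le_rfl, by omega, by simp⟩, by simp⟩

/-- If `⟨B⟩ = τ_j(⟨B'⟩) + F₂ e_j`, then `B` consists of `{j}` and the intervals obtained from those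
of `B'` by expanding the index `j - 1` to `{j - 1, j, j + 1}`. -/
lemma mem_iff_of_spanB_eq (hD : 4 ≤ D) (hDev : Even D) {j : ℕ} (hj1 : 1 ≤ j) (hj2 : j ≤ D + 1)
    {B' : Finset (Finset (ZMod (D - 2 + 1)))} (hB' : phi (D - 2) B')
    {B : Finset (Finset (ZMod (D + 1)))} (hB : phi D B)
    (hspan : ∀ x, x ∈ spanB D B ↔ ∃ y ∈ spanB (D - 2) B', ∃ c : ZMod 2,
        x = tauMap D j y + c • eV D (j : ZMod (D + 1))) (I : Finset (ZMod (D + 1))) :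
    I ∈ B ↔ I = {(j : ZMod (D + 1))} ∨ ∃ I' ∈ B', pre D j I' = I := by
  have hDev' : Even (D - 2) := by
    rcases hDev with ⟨d, rfl⟩
    exact ⟨d - 1, by omega⟩
  have hjB : {(j : ZMod (D + 1))} ∈ B := by
    refine hB.mem_of_eSet_mem hDev (oddInterval_singleton hD _) ((hspan _).2
      ⟨0, zero_mem _, 1, ?_⟩)
    have h0 : tauMap D j 0 = 0 := by
      simpa [eSet, pre] using eSet_pre hD hj1 hj2 (∅ : Finset (ZMod (D - 2 + 1)))
    rw [h0, eSet, Finset.sum_singleton, one_smul, zero_add]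
  constructor
  · intro hI
    refine or_iff_not_imp_left.2 fun hne => ?_
    have hends : ∀ s : ZMod (D + 1), s = 1 ∨ s = -1 →
        ((j : ZMod (D + 1)) - s ∈ I ↔ (j : ZMod (D + 1)) ∈ I) := by
      intro s hs
      have hs0 : (j : ZMod (D + 1)) - s ∉ ({(j : ZMod (D + 1))} : Finset _) := by
        rw [Finset.mem_singleton, sub_eq_self]
        rintro rfl
        have h1 : (1 : ZMod (D + 1)) = 0 := by
          have := dir_mul_self hs
          rw [← this, mul_zero]
        have := natCast_inj_of_le (D := D) (u := 1) (v := 0) (by omega) (by omega)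
          (by simpa using h1)
        omega
      rcases hB.2.1 _ hjB I hI with h | h | h | h
      · exact absurd h.symm hne
      · exact iff_of_false
          (h.sub_dir_notMem hDev hs (oddInterval_singleton hD _) (hB.1 I hI)
            (Finset.mem_singleton_self _) hs0)
          (h.notMem (Finset.mem_singleton_self _))
      · have hj : (j : ZMod (D + 1)) ∈ I := h.1.1 (Finset.mem_singleton_self _)
        refine iff_of_true ?_ hj
        by_contra hjs
        exact hB.start_notMem hDev hs hI hjB h.1 hj hjs (Finset.mem_singleton_self _)
      · have hlt := Finset.card_lt_card h.1
        have := (hB.1 I hI).2.pos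
        rw [Finset.card_singleton] at hlt
        omega
    have hends' := hends (-1) (Or.inr rfl)
    rw [sub_neg_eq_add] at hends'
    obtain ⟨I', hI', rfl⟩ := exists_oddInterval_pre hD hDev (hB.1 I hI) (hends 1 (Or.inl rfl))
      hends'
    refine ⟨I', hB'.mem_of_eSet_mem hDev' hI' ?_, rfl⟩
    obtain ⟨y, hy, c, hyc⟩ := (hspan _).1 ((hB.mem_iff_eSet_mem hDev (hB.1 _ hI)).1 hI)
    rw [← eSet_pre hD hj1 hj2] at hyc
    rwa [eq_of_tauMap_add_eq hD hj1 hj2 hyc]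
  · rintro (rfl | ⟨I', hI', rfl⟩)
    · exact hjB
    · have hodd := hB'.1 I' hI'
      refine hB.mem_of_eSet_mem hDev (oddInterval_pre hD hDev j hodd) ((hspan _).2
        ⟨_, (hB'.mem_iff_eSet_mem hDev' hodd).1 hI', 0, ?_⟩)
      rw [eSet_pre hD hj1 hj2, zero_smul, add_zero]

lemma gB_eq_of_mem_iff (hD : 4 ≤ D) {j : ℕ} {B' : Finset (Finset (ZMod (D - 2 + 1)))}
    {B : Finset (Finset (ZMod (D + 1)))}
    (h : ∀ I, I ∈ B ↔ I = {(j : ZMod (D + 1))} ∨ ∃ I' ∈ B', pre D j I' = I)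
    {i : ZMod (D + 1)} (hi : i ≠ j) : gB D B i = gB (D - 2) B' (collapse D j i) := by
  rw [gB, gB, ← Finset.card_image_of_injective _ (pre_injective hD j)]
  congr 1
  ext I
  simp only [Finset.mem_filter, Finset.mem_image, h]
  constructor
  · rintro ⟨rfl | ⟨I', hI', rfl⟩, hiI⟩
    · exact absurd (Finset.mem_singleton.1 hiI) hi
    · exact ⟨I', ⟨hI', mem_pre.1 hiI⟩, rfl⟩
  · rintro ⟨I', ⟨hI', hiI⟩, rfl⟩
    exact ⟨Or.inr ⟨I', hI', rfl⟩, mem_pre.2 hiI⟩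

end Main

/-- Statement 2.2(e): if `⟨B⟩ = τ_j(⟨B'⟩) + F₂·e_j` then `ε(B) = τ_j(ε'(B'))` or
`ε(B) = τ_j(ε'(B')) + e_j`. -/
theorem eps_compat_tau (D : ℕ) (hD : 4 ≤ D) (hDev : Even D)
    (j : ℕ) (hj1 : 1 ≤ j) (hj2 : j ≤ D + 1)
    (B' : Finset (Finset (ZMod (D - 2 + 1)))) (hB' : phi (D - 2) B')
    (B : Finset (Finset (ZMod (D + 1)))) (hB : phi D B)
    (hspan : (spanB D B : Set (Vsp D)) =
      {x : Vsp D | ∃ y ∈ (spanB (D - 2) B' : Set (Vsp (D - 2))), ∃ c : ZMod 2,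
        x = tauMap D j y + c • eV D (j : ZMod (D + 1))}) :
    epsB D B = tauMap D j (epsB (D - 2) B') ∨
    epsB D B = tauMap D j (epsB (D - 2) B') + eV D (j : ZMod (D + 1)) := by
  have hmem := mem_iff_of_spanB_eq hD hDev hj1 hj2 hB' hB fun x => Set.ext_iff.1 hspan x
  rw [epsB_eq, epsB_eq, tauMap_toV hD hj1 hj2, eV_eq, ← map_add]
  have hoff : ∀ i, i ≠ (j : ZMod (D + 1)) → epsW B i = (epsW B' ∘ collapse D j) i := fun i hi => by
    rw [Function.comp_apply, epsW, epsW, gB_eq_of_mem_iff hD hmem hi]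
  obtain ⟨c, hc⟩ : ∃ c, epsW B j = (epsW B' ∘ collapse D j) j + c :=
    ⟨epsW B j - (epsW B' ∘ collapse D j) j, by ring⟩
  refine (zmod_two_cases c).imp ?_ ?_ <;> rintro rfl <;> congr 1 <;> ext i <;>
    by_cases hi : i = (j : ZMod (D + 1))
  · rw [hi, hc, add_zero]
  · exact hoff i hi
  · rw [hi, hc, Pi.add_apply]
    simp [indW]
  · rw [hoff i hi, Pi.add_apply]
    simp [indW, hi]
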